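/- There is no 3×3 real Fourier matrix S satisfying the integrality hypothesis with S_{01} = S_{02} (equivalently, with equal degrees k₁ = k₂, i.e., the associated C-algebra is homogeneous). -/

import Mathlib

open Complex Matrix BigOperators

namespace FourierPaper

noncomputable section

/-- A Fourier matrix: symmetric, unitary, positive real 0-th column,
integral structure constants `N_{ijk}`. -/
structure IsFourier {r : ℕ} [NeZero r] (S : Matrix (Fin r) (Fin r) ℂ) : Prop where
  symm : ∀ i j, S i j = S j i
  unitary : S * S.conjTranspose = 1
  col0_real : ∀ i, (S i 0).im = 0
  col0_pos : ∀ i, 0 < (S i 0).re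
  structInt : ∀ i j k : Fin r, ∃ z : ℤ,
    (∑ l, S l i * S l j * (starRingEnd ℂ) (S l k) / S l 0) = (z : ℂ)

/-- The Allen matrix of `S`: `s i j = S i j / S i 0`. -/
def allen {r : ℕ} [NeZero r] (S : Matrix (Fin r) (Fin r) ℂ) : Matrix (Fin r) (Fin r) ℂ :=
  fun i j => S i j / S i 0

/-- The character table (first eigenmatrix): `p i j = s i j * s 0 j`. -/
def charTable {r : ℕ} [NeZero r] (S : Matrix (Fin r) (Fin r) ℂ) : Matrix (Fin r) (Fin r) ℂ :=
  fun i j => allen S i j * allen S 0 j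

/-- The norm `d_i = ∑_j |s i j|²`. -/
def nrm {r : ℕ} [NeZero r] (S : Matrix (Fin r) (Fin r) ℂ) (i : Fin r) : ℝ :=
  ∑ j, Complex.normSq (allen S i j)

/-- The degree `k_j = s_{0j}²` (a positive real, as `s 0 j` is a positive real). -/
def deg {r : ℕ} [NeZero r] (S : Matrix (Fin r) (Fin r) ℂ) (j : Fin r) : ℝ :=
  ((allen S 0 j).re) ^ 2

/-- The structure constant `N_{ijk}`. -/
def Nstruct {r : ℕ} [NeZero r] (S : Matrix (Fin r) (Fin r) ℂ) (i j k : Fin r) : ℂ :=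
  ∑ l, S l i * S l j * (starRingEnd ℂ) (S l k) / S l 0

/-- The structure constant `λ_{ijk}` of the character-table basis. -/
def lam {r : ℕ} [NeZero r] (S : Matrix (Fin r) (Fin r) ℂ) (i j k : Fin r) : ℂ :=
  Nstruct S i j k * allen S 0 i * allen S 0 j / allen S 0 k

/-- `S` has all real entries. -/
def RealMatrix {r : ℕ} (S : Matrix (Fin r) (Fin r) ℂ) : Prop :=
  ∀ i j, (S i j).im = 0

/-- Integrality hypothesis: every norm `d_i` is a positive integer dividing `d_0`. -/
def IntegralityHyp {r : ℕ} [NeZero r] (S : Matrix (Fin r) (Fin r) ℂ) : Prop :=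
  ∃ D : Fin r → ℕ, (∀ i, 0 < D i) ∧ (∀ i, nrm S i = (D i : ℝ)) ∧ (∀ i, D i ∣ D 0)

/-- there is no `3 × 3` real Fourier matrix satisfying the
integrality hypothesis with equal degrees `k₁ = k₂` (i.e. `S 0 1 = S 0 2`). -/
theorem stmt10 (S : Matrix (Fin 3) (Fin 3) ℂ)
    (hS : IsFourier S) (hreal : RealMatrix S)
    (hint : IntegralityHyp S) (hhom : S 0 1 = S 0 2) :
    False := by
  obtain ⟨D, hpos, hn, hd⟩ := hint
  have hr : ∀ i j, S i j = (((S i j).re : ℝ) : ℂ) := fun i j => by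
    apply Complex.ext <;> simp [hreal i j]
  obtain ⟨R, hR⟩ : ∃ R : Fin 3 → Fin 3 → ℝ, ∀ i j, S i j = ((R i j : ℝ) : ℂ) :=
    ⟨fun i j => (S i j).re, hr⟩
  have hsym : ∀ i j, R i j = R j i := fun i j => by
    have := hS.symm i j
    rw [hR, hR] at this
    exact_mod_cast this
  have hp : ∀ i, 0 < R i 0 := fun i => by
    have := hS.col0_pos i
    rw [hR] at this
    simpa using this
  have hU : ∀ i j, R i 0 * R j 0 + R i 1 * R j 1 + R i 2 * R j 2 = if i = j then 1 else 0 := by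
    intro i j
    have := congrFun (congrFun hS.unitary i) j
    simp only [Matrix.mul_apply, Fin.sum_univ_three, Matrix.conjTranspose_apply, hR,
      Complex.star_def, Complex.conj_ofReal, Matrix.one_apply] at this
    split_ifs at this ⊢ <;> exact_mod_cast this
  have h12 : R 0 1 = R 0 2 := by
    rw [hR, hR] at hhom
    exact_mod_cast hhom
  have hD : ∀ i, (D i : ℝ) * (R i 0) ^ 2 = 1 := by
    intro i
    have h0 := (hp i).ne'
    have h1 := hU i i
    simp only [if_true] at h1
    rw [← hn i, nrm]
    simp only [allen, hR, Fin.sum_univ_three, ← Complex.ofReal_div, Complex.normSq_ofReal]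
    field_simp
    linarith
  obtain ⟨z, hz⟩ := hS.structInt 1 1 1
  simp only [Fin.sum_univ_three, hR, Complex.conj_ofReal] at hz
  have hz' : R 0 1 * R 0 1 * R 0 1 / R 0 0 + R 1 1 * R 1 1 * R 1 1 / R 1 0
      + R 2 1 * R 2 1 * R 2 1 / R 2 0 = (z : ℝ) := by exact_mod_cast hz
  have u00 := hU 0 0
  have u01 := hU 0 1
  have u11 := hU 1 1
  have u02 := hU 0 2
  have u12 := hU 1 2
  simp at u00 u01 u11 u02 u12
  obtain ⟨c, hc⟩ := hd 1
  have d0 := hD 0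
  have d1 := hD 1
  have p0 := hp 0
  have p1 := hp 1
  have e10 := hsym 1 0
  have e20 := hsym 2 0
  have e21 := hsym 2 1
  rw [hc] at d0
  rw [e10] at d1 u01 u11 u12 p1 hz'
  rw [e20, ← h12] at u12 u02 hz'
  rw [e21] at u12 u02 hz'
  rw [← h12] at u00 u01
  generalize R 0 0 = a at *
  generalize R 0 1 = b at *
  generalize R 1 1 = x at *
  generalize R 1 2 = y at *
  generalize R 2 2 = w at *
  push_cast at d0
  have hb : b ^ 2 = c * a ^ 2 := by
    have : b ^ 2 * ((D 1 : ℝ) * c * a ^ 2) = c * a ^ 2 * (D 1 * b ^ 2) := by ring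
    rwa [d0, d1, mul_one, mul_one] at this
  have hDc : D 1 * c = 1 + 2 * c := by
    have ha : a ^ 2 ≠ 0 := by positivity
    have : (D 1 : ℝ) * c = 1 + 2 * c := by
      apply mul_right_cancel₀ ha
      nlinarith
    exact_mod_cast this
  have hc1 : c = 1 := by
    have h : c ∣ 1 + 2 * c := ⟨D 1, by rw [← hDc]; ring⟩
    exact Nat.dvd_one.mp ((Nat.dvd_add_left (Dvd.intro_left 2 rfl)).mp h)
  subst hc1
  have hab : b = a := by
    have : b ^ 2 = a ^ 2 := by simpa using hb
    exact (pow_left_inj₀ p1.le p0.le two_ne_zero).mp this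
  subst hab
  have s1 : x + y = -b := by
    apply mul_left_cancel₀ p0.ne'
    linarith
  have s2 : y + w = -b := by
    apply mul_left_cancel₀ p0.ne'
    linarith
  have hw : w = x := by linarith
  subst hw
  have hy : y = -b - w := by linarith
  subst hy
  have hz2 : (z : ℝ) = -1 / 2 := by
    rw [← hz']
    field_simp
    have hq : b * b = 1 / 3 := by linarith
    have hx : w * w = 1 / 6 - b * w := by linarith
    have hx3 : w * w * w = w / 6 - b * (1 / 6 - b * w) := by
      rw [hx]; linear_combination (-b) * hx
    nlinarith
  have : (2 * z : ℤ) = -1 := by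
    have : (2 * z : ℝ) = -1 := by linarith
    exact_mod_cast this
  omega

end

end FourierPaper
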